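/- Assume Assumptions A1 and A2 hold for every arc a ∈ A. For each a ∈ A let c^max_a denote the optimal value of the linear program: maximize ∑_{j=1}^{W_a} U_a^{(j)} δ_j over δ ∈ ℝ^{W_a} subject to δ ≥ 0, ∑_{j=1}^{W_a} δ_j = 1, and q̲_a^{(i)} ≤ ∑_{j ∈ W_a(i)} δ_j ≤ q̄_a^{(i)} for every i ∈ {1,…,D_a}. Then the optimal value of the distributionally robust shortest path problem without expectation constraints equals the optimal value of the deterministic shortest path problem with arc costs c^max_a: min_{y ∈ Y} sup_{Q : Q_a ∈ Q̃_a ∀a} E_Q[∑_{a∈A} c_a y_a] = min_{y ∈ Y} ∑_{a∈A} c^max_a y_a, and a vector y* ∈ Y is optimal for the former problem if and only if it is optimal for the latter. -/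

import Mathlib

open MeasureTheory Set
open scoped Classical

noncomputable section

/-- The quantile ambiguity set `Q̃_a` for a single arc. -/
def ambSet (D : ℕ) (lo hi ql qh : Fin D → ℝ) : Set (Measure ℝ) :=
  {Q | IsProbabilityMeasure Q ∧ ∀ i : Fin D,
    ql i ≤ (Q (Icc (lo i) (hi i))).toReal ∧ (Q (Icc (lo i) (hi i))).toReal ≤ qh i}

/-- The joint ambiguity set (no expectation constraints). -/
def jointSet {A : Type*} [Fintype A] (D : A → ℕ)
    (lo hi ql qh : (a : A) → Fin (D a) → ℝ) : Set (Measure (A → ℝ)) :=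
  {Q | IsProbabilityMeasure Q ∧
    ∀ a : A, Q.map (fun c => c a) ∈ ambSet (D a) (lo a) (hi a) (ql a) (qh a)}

/-- The worst-case expected cost of `y` over the joint ambiguity set. -/
def worstVal {A : Type*} [Fintype A] (D : A → ℕ)
    (lo hi ql qh : (a : A) → Fin (D a) → ℝ) (y : A → ℝ) : ℝ :=
  sSup ((fun Q : Measure (A → ℝ) => ∫ c, ∑ a, c a * y a ∂Q) '' jointSet D lo hi ql qh)

/-- Feasibility for the per-arc primal linear program over elementary subintervals. -/
def lpFeas (D W : ℕ) (lo hi ql qh : Fin D → ℝ) (e : Fin (W + 1) → ℝ) (δ : Fin W → ℝ) : Prop :=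
  (∀ j, 0 ≤ δ j) ∧ (∑ j, δ j) = 1 ∧
    ∀ i : Fin D,
      ql i ≤ (∑ j ∈ Finset.univ.filter
          (fun j : Fin W => Icc (e j.castSucc) (e j.succ) ⊆ Icc (lo i) (hi i)), δ j) ∧
      (∑ j ∈ Finset.univ.filter
          (fun j : Fin W => Icc (e j.castSucc) (e j.succ) ⊆ Icc (lo i) (hi i)), δ j) ≤ qh i

section Cells

variable {W : ℕ} {e : Fin (W + 1) → ℝ}

theorem exists_castSucc_le_lt_succ {x : ℝ} (h0 : e 0 ≤ x) (h1 : x < e (Fin.last W)) :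
    ∃ j : Fin W, e j.castSucc ≤ x ∧ x < e j.succ := by
  by_contra! h
  have : ∀ k, e k ≤ x := fun k => Fin.induction h0 (fun j hj => h j hj) k
  exact absurd h1 (not_lt.2 (this _))

theorem exists_castSucc_lt_le_succ {x : ℝ} (h0 : e 0 < x) (h1 : x ≤ e (Fin.last W)) :
    ∃ j : Fin W, e j.castSucc < x ∧ x ≤ e j.succ := by
  by_contra! h
  have : ∀ k, e k < x := fun k => Fin.induction h0 (fun j hj => h j hj) k
  exact absurd h1 (not_le.2 (this _))

theorem StrictMono.le_castSucc_of_lt_succ (he : StrictMono e) {j : Fin W} {y : ℝ}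
    (hy : y ∈ range e) (h : y < e j.succ) : y ≤ e j.castSucc := by
  obtain ⟨k, rfl⟩ := hy
  exact he.monotone (Fin.le_castSucc_iff.2 (he.lt_iff_lt.1 h))

theorem StrictMono.succ_le_of_castSucc_lt (he : StrictMono e) {j : Fin W} {y : ℝ}
    (hy : y ∈ range e) (h : e j.castSucc < y) : e j.succ ≤ y := by
  obtain ⟨k, rfl⟩ := hy
  exact he.monotone (Fin.castSucc_lt_iff_succ_le.1 (he.lt_iff_lt.1 h))

/-- A point `x` of an elementary subinterval lies in `[lo, hi]` exactly when the whole subinterval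
does, provided `x` is neither its right end equal to `lo` nor its left end equal to `hi`. -/
theorem StrictMono.Icc_cell_subset_iff (he : StrictMono e) {j : Fin W} {x lo hi : ℝ}
    (hlo : lo ∈ range e) (hhi : hi ∈ range e)
    (h1 : e j.castSucc ≤ x) (h2 : x ≤ e j.succ)
    (hlt : lo ≤ x → lo < e j.succ) (hgt : x ≤ hi → e j.castSucc < hi) :
    Icc (e j.castSucc) (e j.succ) ⊆ Icc lo hi ↔ x ∈ Icc lo hi :=
  ⟨fun h => h ⟨h1, h2⟩, fun h => Icc_subset_Icc
    (he.le_castSucc_of_lt_succ hlo (hlt h.1)) (he.succ_le_of_castSucc_lt hhi (hgt h.2))⟩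

variable {D : ℕ} {lo hi : Fin D → ℝ}

/-- The points of the `j`-th elementary subinterval lying in exactly those `[lo i, hi i]`
that contain the whole elementary subinterval. -/
def cell (lo hi : Fin D → ℝ) (e : Fin (W + 1) → ℝ) (j : Fin W) : Set ℝ :=
  {x | x ∈ Icc (e j.castSucc) (e j.succ) ∧
    ∀ i, Icc (e j.castSucc) (e j.succ) ⊆ Icc (lo i) (hi i) ↔ x ∈ Icc (lo i) (hi i)}

theorem measurableSet_cell (j : Fin W) : MeasurableSet (cell lo hi e j) := by
  have : cell lo hi e j = Icc (e j.castSucc) (e j.succ) ∩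
      ⋂ i, {x | Icc (e j.castSucc) (e j.succ) ⊆ Icc (lo i) (hi i) ↔ x ∈ Icc (lo i) (hi i)} := by
    ext x; simp [cell]
  rw [this]
  refine measurableSet_Icc.inter (MeasurableSet.iInter fun i => ?_)
  by_cases h : Icc (e j.castSucc) (e j.succ) ⊆ Icc (lo i) (hi i)
  · simp only [h, true_iff]
    exact measurableSet_Icc
  · simp only [h, false_iff]
    exact measurableSet_Icc.compl

theorem exists_mem_cell (he : StrictMono e) (hr : range e = range lo ∪ range hi)
    (hlohi : ∀ i, lo i ≤ hi i) (hne : ∀ i k, lo i ≠ hi k) {x : ℝ} {m : Fin D}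
    (hlast : e (Fin.last W) = hi m)
    (hx : x ∈ Icc (e 0) (e (Fin.last W))) : ∃ j, x ∈ cell lo hi e j := by
  have hlo : ∀ i, lo i ∈ range e := fun i => hr ▸ Or.inl ⟨i, rfl⟩
  have hhi : ∀ i, hi i ∈ range e := fun i => hr ▸ Or.inr ⟨i, rfl⟩
  by_cases hxh : ∃ k, hi k = x
  · obtain ⟨k, rfl⟩ := hxh
    have h0 : e 0 < hi k := by
      obtain ⟨n, hn⟩ := hlo k
      exact (he.monotone (Fin.zero_le n)).trans_lt (hn ▸ (hlohi k).lt_of_ne (hne k k))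
    obtain ⟨j, h1, h2⟩ := exists_castSucc_lt_le_succ h0 hx.2
    exact ⟨j, ⟨h1.le, h2⟩, fun i => he.Icc_cell_subset_iff (hlo i) (hhi i) h1.le h2
      (fun h => (h.lt_of_ne (hne i k)).trans_le h2) (fun h => h1.trans_le h)⟩
  · push Not at hxh
    obtain ⟨j, h1, h2⟩ := exists_castSucc_le_lt_succ hx.1
      (hx.2.lt_of_ne (hlast ▸ (hxh m).symm))
    exact ⟨j, ⟨h1, h2.le⟩, fun i => he.Icc_cell_subset_iff (hlo i) (hhi i) h1 h2.le
      (fun h => h.trans_lt h2) (fun h => h1.trans_lt (h.lt_of_ne (hxh i).symm))⟩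

theorem pairwise_disjoint_cell (he : StrictMono e) (hr : range e = range lo ∪ range hi)
    (hlohi : ∀ i, lo i ≤ hi i) : Pairwise (Function.onFun Disjoint (cell lo hi e)) := by
  refine (pairwise_disjoint_on _).2 fun j k hjk => Set.disjoint_left.2 fun x hxj hxk => ?_
  have hle : e j.succ ≤ e k.castSucc := he.monotone (Fin.le_castSucc_iff.2 (by simpa using hjk))
  have h1 : x = e j.succ := le_antisymm hxj.1.2 (hle.trans hxk.1.1)
  have h2 : x = e k.castSucc := le_antisymm (hxj.1.2.trans hle) hxk.1.1
  have hj := he (Fin.castSucc_lt_succ (i := j))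
  have hk := he (Fin.castSucc_lt_succ (i := k))
  have hx : x ∈ range lo ∪ range hi := hr ▸ ⟨_, h1.symm⟩
  rcases hx with ⟨i, hi'⟩ | ⟨i, hi'⟩
  · have := (hxj.2 i).2 ⟨hi'.le, hi' ▸ hlohi i⟩ (left_mem_Icc.2 hj.le)
    linarith [this.1]
  · have := (hxk.2 i).2 ⟨hi' ▸ hlohi i, hi'.ge⟩ (right_mem_Icc.2 hk.le)
    linarith [this.2]

end Cells

section SingleArc

variable {D W : ℕ} {lo hi ql qh : Fin D → ℝ} {e : Fin (W + 1) → ℝ}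

theorem ae_mem_Icc_of_mem_ambSet {Q : Measure ℝ} (hQ : Q ∈ ambSet D lo hi ql qh) {m : Fin D}
    (hqm : ql m = 1) : ∀ᵐ x ∂Q, x ∈ Icc (lo m) (hi m) := by
  have := hQ.1
  have h := (hQ.2 m).1
  rw [hqm, ← measureReal_def] at h
  have h1 : Q.real (Icc (lo m) (hi m)) = 1 := le_antisymm measureReal_le_one h
  exact (mem_ae_iff_prob_eq_one measurableSet_Icc).2
    ((ENNReal.toReal_eq_one_iff _).1 h1)

theorem integrable_id_of_mem_ambSet {Q : Measure ℝ} (hQ : Q ∈ ambSet D lo hi ql qh) {m : Fin D}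
    (hqm : ql m = 1) : Integrable (fun x : ℝ => x) Q :=
  have := hQ.1
  Integrable.of_mem_Icc _ _ aemeasurable_id (ae_mem_Icc_of_mem_ambSet hQ hqm)

/-- Every admissible measure induces a feasible point of the linear program with an objective
value at least the mean of the measure. -/
theorem exists_lpFeas_integral_le (he : StrictMono e) (hr : range e = range lo ∪ range hi)
    (hlohi : ∀ i, lo i ≤ hi i) (hne : ∀ i k, lo i ≠ hi k) {m : Fin D}
    (hlo : ∀ i, lo m ≤ lo i) (hhi : ∀ i, hi i ≤ hi m) (hfirst : e 0 = lo m)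
    (hlast : e (Fin.last W) = hi m) (hqm : ql m = 1)
    {Q : Measure ℝ} (hQ : Q ∈ ambSet D lo hi ql qh) :
    ∃ δ, lpFeas D W lo hi ql qh e δ ∧ ∫ x, x ∂Q ≤ ∑ j, e j.succ * δ j := by
  have := hQ.1
  have hint := integrable_id_of_mem_ambSet hQ hqm
  have hae : ∀ᵐ x ∂Q, x ∈ ⋃ j, cell lo hi e j := by
    filter_upwards [ae_mem_Icc_of_mem_ambSet hQ hqm] with x hx
    exact mem_iUnion.2 (exists_mem_cell he hr hlohi hne hlast (hfirst ▸ hlast ▸ hx))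
  have hdisj := pairwise_disjoint_cell he hr hlohi
  have hmeas := measurableSet_cell (lo := lo) (hi := hi) (e := e)
  have hIcc : ∀ i, (∑ j ∈ Finset.univ.filter
      (fun j : Fin W => Icc (e j.castSucc) (e j.succ) ⊆ Icc (lo i) (hi i)),
        Q.real (cell lo hi e j)) = (Q (Icc (lo i) (hi i))).toReal := by
    intro i
    rw [← measureReal_biUnion_finset (fun j _ k _ hjk => hdisj hjk) (fun j _ => hmeas j)]
    change Q.real _ = Q.real _
    congr 1
    ext x
    simp only [Finset.mem_filter, Finset.mem_univ, true_and, mem_iUnion, exists_prop]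
    constructor
    · rintro ⟨j, hj, hx⟩
      exact (hx.2 i).1 hj
    · intro hx
      obtain ⟨j, hj⟩ := exists_mem_cell he hr hlohi hne hlast (x := x)
        ⟨hfirst ▸ (hlo i).trans hx.1, hlast ▸ hx.2.trans (hhi i)⟩
      exact ⟨j, (hj.2 i).2 hx, hj⟩
  refine ⟨fun j => Q.real (cell lo hi e j), ⟨fun j => measureReal_nonneg, ?_, fun i => ?_⟩, ?_⟩
  · rw [← measureReal_iUnion_fintype hdisj hmeas, measureReal_def,
      (mem_ae_iff_prob_eq_one (MeasurableSet.iUnion hmeas)).1 hae, ENNReal.toReal_one]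
  · rw [hIcc]
    exact hQ.2 i
  · rw [← setIntegral_eq_integral_of_ae_compl_eq_zero
      (s := ⋃ j, cell lo hi e j) (by filter_upwards [hae] with x hx h using absurd hx h),
      integral_iUnion_fintype hmeas hdisj (fun j => hint.integrableOn)]
    refine Finset.sum_le_sum fun j _ => ?_
    calc ∫ x in cell lo hi e j, x ∂Q ≤ ∫ x in cell lo hi e j, e j.succ ∂Q :=
          setIntegral_mono_on hint.integrableOn (integrable_const _).integrableOn (hmeas j)
            fun x hx => hx.1.2
      _ = e j.succ * Q.real (cell lo hi e j) := by
          rw [setIntegral_const, smul_eq_mul, mul_comm]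

/-- A feasible point of the linear program and a choice of interior points of the
elementary subintervals give an admissible discrete measure. -/
theorem exists_mem_ambSet_integral_eq (he : StrictMono e) (hr : range e = range lo ∪ range hi)
    {δ : Fin W → ℝ} (hδ : lpFeas D W lo hi ql qh e δ) {p : Fin W → ℝ}
    (hp : ∀ j, p j ∈ Ioo (e j.castSucc) (e j.succ)) :
    ∃ Q ∈ ambSet D lo hi ql qh, ∫ x, x ∂Q = ∑ j, p j * δ j := by
  have hlo : ∀ i, lo i ∈ range e := fun i => hr ▸ Or.inl ⟨i, rfl⟩
  have hhi : ∀ i, hi i ∈ range e := fun i => hr ▸ Or.inr ⟨i, rfl⟩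
  refine ⟨∑ j, ENNReal.ofReal (δ j) • Measure.dirac (p j), ⟨⟨?_⟩, fun i => ?_⟩, ?_⟩
  · simp [← ENNReal.ofReal_sum_of_nonneg fun j _ => hδ.1 j, hδ.2.1]
  · have : ((∑ j, ENNReal.ofReal (δ j) • Measure.dirac (p j)) (Icc (lo i) (hi i))).toReal =
        ∑ j ∈ Finset.univ.filter
          (fun j : Fin W => Icc (e j.castSucc) (e j.succ) ⊆ Icc (lo i) (hi i)), δ j := by
      rw [Measure.finsetSum_apply, ENNReal.toReal_sum, Finset.sum_filter]
      · refine Finset.sum_congr rfl fun j _ => ?_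
        rw [he.Icc_cell_subset_iff (hlo i) (hhi i) (hp j).1.le (hp j).2.le
          (fun h => h.trans_lt (hp j).2) (fun h => (hp j).1.trans_le h)]
        rw [Measure.smul_apply, Measure.dirac_apply' _ measurableSet_Icc]
        by_cases h : p j ∈ Icc (lo i) (hi i)
        · rw [if_pos h, indicator_of_mem h]
          simp [hδ.1 j]
        · rw [if_neg h, indicator_of_notMem h]
          simp
      · intro j _
        exact ENNReal.mul_ne_top ENNReal.ofReal_ne_top (measure_ne_top _ _)
    rw [this]
    exact hδ.2.2 i
  · rw [integral_finsetSum_measure fun j _ =>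
      (integrable_dirac (by simp)).smul_measure ENNReal.ofReal_ne_top]
    refine Finset.sum_congr rfl fun j _ => ?_
    rw [integral_smul_measure, integral_dirac, ENNReal.toReal_ofReal (hδ.1 j), smul_eq_mul,
      mul_comm]

/-- The supremum of the means of the admissible measures is the optimal value of the
linear program. -/
theorem isLUB_integral_ambSet (he : StrictMono e) (hr : range e = range lo ∪ range hi)
    (hlohi : ∀ i, lo i ≤ hi i) (hne : ∀ i k, lo i ≠ hi k) {m : Fin D}
    (hlo : ∀ i, lo m ≤ lo i) (hhi : ∀ i, hi i ≤ hi m) (hqm : ql m = 1)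
    (hQ : (ambSet D lo hi ql qh).Nonempty) :
    IsLUB ((fun Q : Measure ℝ => ∫ x, x ∂Q) '' ambSet D lo hi ql qh)
      (sSup {x : ℝ | ∃ δ : Fin W → ℝ, lpFeas D W lo hi ql qh e δ ∧
        x = ∑ j, e j.succ * δ j}) := by
  have hmem : ∀ k, lo m ≤ e k ∧ e k ≤ hi m := by
    intro k
    have : e k ∈ range lo ∪ range hi := hr ▸ ⟨k, rfl⟩
    rcases this with ⟨i, h⟩ | ⟨i, h⟩
    · exact ⟨h ▸ hlo i, h ▸ (hlohi i).trans (hhi i)⟩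
    · exact ⟨h ▸ (hlo i).trans (hlohi i), h ▸ hhi i⟩
  have hfirst : e 0 = lo m := by
    obtain ⟨k, hk⟩ : lo m ∈ range e := hr ▸ Or.inl ⟨m, rfl⟩
    exact le_antisymm (hk ▸ he.monotone (Fin.zero_le k)) (hmem 0).1
  have hlast : e (Fin.last W) = hi m := by
    obtain ⟨k, hk⟩ : hi m ∈ range e := hr ▸ Or.inr ⟨m, rfl⟩
    exact le_antisymm (hmem _).2 (hk ▸ he.monotone (Fin.le_last k))
  have hbdd : BddAbove {x : ℝ | ∃ δ : Fin W → ℝ, lpFeas D W lo hi ql qh e δ ∧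
      x = ∑ j, e j.succ * δ j} := by
    refine ⟨hi m, ?_⟩
    rintro x ⟨δ, hδ, rfl⟩
    calc ∑ j, e j.succ * δ j ≤ ∑ j, hi m * δ j :=
          Finset.sum_le_sum fun j _ => mul_le_mul_of_nonneg_right (hmem _).2 (hδ.1 j)
      _ = hi m := by rw [← Finset.mul_sum, hδ.2.1, mul_one]
  have hle : ∀ Q ∈ ambSet D lo hi ql qh, ∃ δ, lpFeas D W lo hi ql qh e δ ∧
      ∫ x, x ∂Q ≤ ∑ j, e j.succ * δ j := fun Q hQ =>
    exists_lpFeas_integral_le he hr hlohi hne hlo hhi hfirst hlast hqm hQ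
  constructor
  · rintro _ ⟨Q, hQ, rfl⟩
    obtain ⟨δ, hδ, h⟩ := hle Q hQ
    exact h.trans (le_csSup hbdd ⟨δ, hδ, rfl⟩)
  · intro b hb
    refine csSup_le ?_ ?_
    · obtain ⟨Q, hQ⟩ := hQ
      obtain ⟨δ, hδ, -⟩ := hle Q hQ
      exact ⟨_, δ, hδ, rfl⟩
    · rintro x ⟨δ, hδ, rfl⟩
      have hlim : Filter.Tendsto
          (fun t : ℝ => ∑ j, (e j.succ - t * (e j.succ - e j.castSucc)) * δ j)
          (nhdsWithin 0 (Ioi 0)) (nhds (∑ j, e j.succ * δ j)) := by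
        have : Continuous
            (fun t : ℝ => ∑ j, (e j.succ - t * (e j.succ - e j.castSucc)) * δ j) := by
          fun_prop
        simpa using (this.tendsto 0).mono_left nhdsWithin_le_nhds
      refine le_of_tendsto hlim ?_
      filter_upwards [Ioo_mem_nhdsGT (zero_lt_one (α := ℝ))] with t ht
      obtain ⟨Q, hQ, h⟩ := exists_mem_ambSet_integral_eq he hr hδ
        (p := fun j => e j.succ - t * (e j.succ - e j.castSucc)) fun j => by
          have := he (Fin.castSucc_lt_succ (i := j))
          constructor <;> nlinarith [ht.1, ht.2]
      exact h ▸ hb ⟨Q, hQ, rfl⟩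

end SingleArc

/-- If the admissible marginals are integrable and `M a` is the supremum of their means, the
worst-case cost of a nonnegative `y` decomposes over the arcs. -/
theorem worstVal_eq_sum {A : Type*} [Fintype A] {D : A → ℕ}
    {lo hi ql qh : (a : A) → Fin (D a) → ℝ} {M : A → ℝ}
    (hint : ∀ a, ∀ Q ∈ ambSet (D a) (lo a) (hi a) (ql a) (qh a),
      Integrable (fun x : ℝ => x) Q)
    (hM : ∀ a, IsLUB ((fun Q : Measure ℝ => ∫ x, x ∂Q) ''
      ambSet (D a) (lo a) (hi a) (ql a) (qh a)) (M a))
    (hne : ∀ a, (ambSet (D a) (lo a) (hi a) (ql a) (qh a)).Nonempty)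
    {y : A → ℝ} (hy : ∀ a, 0 ≤ y a) :
    worstVal D lo hi ql qh y = ∑ a, M a * y a := by
  have hval : ∀ Q ∈ jointSet D lo hi ql qh,
      ∫ c, ∑ a, c a * y a ∂Q = ∑ a, (∫ x, x ∂(Q.map fun c => c a)) * y a := by
    intro Q hQ
    have hi' : ∀ a, Integrable (fun c : A → ℝ => c a) Q := fun a =>
      (integrable_map_measure aestronglyMeasurable_id (measurable_pi_apply a).aemeasurable).1
        (hint a _ (hQ.2 a))
    rw [integral_finsetSum _ fun a _ => (hi' a).mul_const _]
    refine Finset.sum_congr rfl fun a _ => ?_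
    have h := integral_map (μ := Q) (measurable_pi_apply a).aemeasurable
      (aestronglyMeasurable_id (α := ℝ))
    simp only [id_eq] at h
    rw [integral_mul_const, h]
  have hpi : ∀ Q : A → Measure ℝ, (∀ a, Q a ∈ ambSet (D a) (lo a) (hi a) (ql a) (qh a)) →
      ∃ P ∈ jointSet D lo hi ql qh, ∀ a, P.map (fun c => c a) = Q a := by
    intro Q hQ
    have := fun a => (hQ a).1
    have hmap : ∀ a, (Measure.pi Q).map (fun c => c a) = Q a := fun a =>
      (measurePreserving_eval Q a).map_eq
    exact ⟨Measure.pi Q, ⟨inferInstance, fun a => (hmap a).symm ▸ hQ a⟩, hmap⟩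
  refine IsLUB.csSup_eq ⟨?_, fun b hb => ?_⟩ ?_
  · rintro _ ⟨Q, hQ, rfl⟩
    simp only [hval Q hQ]
    exact Finset.sum_le_sum fun a _ =>
      mul_le_mul_of_nonneg_right ((hM a).1 ⟨_, hQ.2 a, rfl⟩) (hy a)
  · have hlim : Filter.Tendsto (fun ε : ℝ => ∑ a, (M a - ε) * y a)
        (nhdsWithin 0 (Ioi 0)) (nhds (∑ a, M a * y a)) := by
      have : Continuous (fun ε : ℝ => ∑ a, (M a - ε) * y a) := by fun_prop
      simpa using (this.tendsto 0).mono_left nhdsWithin_le_nhds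
    refine le_of_tendsto hlim ?_
    filter_upwards [self_mem_nhdsWithin] with ε hε
    have hQ : ∀ a, ∃ Q ∈ ambSet (D a) (lo a) (hi a) (ql a) (qh a), M a - ε < ∫ x, x ∂Q := by
      intro a
      obtain ⟨_, ⟨Q, hQ, rfl⟩, h⟩ :=
        ((lt_isLUB_iff (hM a)).1 (sub_lt_self (M a) (mem_Ioi.1 hε)))
      exact ⟨Q, hQ, h⟩
    choose Q hQ hQε using hQ
    obtain ⟨P, hP, hmap⟩ := hpi Q hQ
    refine le_trans ?_ (hb ⟨P, hP, rfl⟩)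
    simp only [hval P hP, hmap]
    exact Finset.sum_le_sum fun a _ => mul_le_mul_of_nonneg_right (hQε a).le (hy a)
  · choose Q hQ using hne
    obtain ⟨P, hP, -⟩ := hpi Q hQ
    exact ⟨_, P, hP, rfl⟩

/-- Under Assumptions A1 and A2 for every arc, the distributionally robust shortest path problem
without expectation constraints has the same optimal value as the deterministic shortest path
problem with arc costs given by the per-arc LP optimal values `c^max_a`, and the optimal
solutions coincide. -/
theorem stmt_9 {A : Type*} [Fintype A] [Nonempty A]
    (D : A → ℕ) (hD : ∀ a, 0 < D a)
    (l u : A → ℝ) (hl0 : ∀ a, 0 ≤ l a) (hlu : ∀ a, l a ≤ u a)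
    (lo hi ql qh : (a : A) → Fin (D a) → ℝ)
    (hllo : ∀ a i, l a ≤ lo a i) (hlohi : ∀ a i, lo a i ≤ hi a i) (hhiu : ∀ a i, hi a i ≤ u a)
    (hql0 : ∀ a i, 0 ≤ ql a i) (hqlqh : ∀ a i, ql a i ≤ qh a i) (hqh1 : ∀ a i, qh a i ≤ 1)
    (hloD : ∀ a, lo a ⟨D a - 1, Nat.sub_lt (hD a) one_pos⟩ = l a)
    (hhiD : ∀ a, hi a ⟨D a - 1, Nat.sub_lt (hD a) one_pos⟩ = u a)
    (hqlD : ∀ a, ql a ⟨D a - 1, Nat.sub_lt (hD a) one_pos⟩ = 1)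
    (hqhD : ∀ a, qh a ⟨D a - 1, Nat.sub_lt (hD a) one_pos⟩ = 1)
    (W : A → ℕ) (e : (a : A) → Fin (W a + 1) → ℝ)
    (hemono : ∀ a, StrictMono (e a))
    (herange : ∀ a, Set.range (e a) = Set.range (lo a) ∪ Set.range (hi a))
    (hA1 : ∀ a, ∃ Q ∈ ambSet (D a) (lo a) (hi a) (ql a) (qh a),
      ∀ i : Fin (D a), ql a i < qh a i →
        ql a i < (Q (Icc (lo a i) (hi a i))).toReal ∧
        (Q (Icc (lo a i) (hi a i))).toReal < qh a i)
    (hA2 : ∀ a, ∀ i₁ i₂ : Fin (D a), lo a i₁ ≠ hi a i₂)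
    (ccmax : A → ℝ)
    (hccmax : ∀ a, ccmax a =
      sSup {x : ℝ | ∃ δ : Fin (W a) → ℝ,
        lpFeas (D a) (W a) (lo a) (hi a) (ql a) (qh a) (e a) δ ∧
        x = ∑ j, e a j.succ * δ j})
    (Y : Finset (A → ℝ)) (hY : Y.Nonempty)
    (hY01 : ∀ y ∈ Y, ∀ a, y a = 0 ∨ y a = 1) :
    sInf (worstVal D lo hi ql qh '' (Y : Set (A → ℝ))) =
      sInf ((fun y : A → ℝ => ∑ a, ccmax a * y a) '' (Y : Set (A → ℝ))) ∧
    (∀ y ∈ Y,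
      (∀ y' ∈ Y, worstVal D lo hi ql qh y ≤ worstVal D lo hi ql qh y') ↔
      (∀ y' ∈ Y, (∑ a, ccmax a * y a) ≤ ∑ a, ccmax a * y' a)) := by
  have key : ∀ y ∈ Y, worstVal D lo hi ql qh y = ∑ a, ccmax a * y a := by
    intro y hy
    have hne : ∀ a, (ambSet (D a) (lo a) (hi a) (ql a) (qh a)).Nonempty := fun a =>
      let ⟨Q, hQ, _⟩ := hA1 a
      ⟨Q, hQ⟩
    refine worstVal_eq_sum (fun a Q hQ => integrable_id_of_mem_ambSet hQ (hqlD a))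
      (fun a => hccmax a ▸ isLUB_integral_ambSet (hemono a) (herange a) (hlohi a) (hA2 a)
        (fun i => hloD a ▸ hllo a i) (fun i => hhiD a ▸ hhiu a i) (hqlD a) (hne a)) hne
      fun a => ?_
    rcases hY01 y hy a with h | h <;> simp [h]
  refine ⟨by rw [Set.image_congr key], fun y hy => ?_⟩
  rw [key y hy]
  exact forall₂_congr fun y' hy' => by rw [key y' hy']
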